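/- Assume k ≥ 2 and let S be a nonempty finite subset of Fin N with |S| = m. Then ξ₂ᵇˡ(S) ≤ 1 + B_k(m) ≤ 1 + r_bl·(N/m + m − 1), i.e., ‖(P_S + μL)⁻¹ * P_S * U_K‖_F² ≤ 1 + r_bl·(N/m) + ∑_{i=2}^{m} ω(max(1, λ_{k+2−i}/λᵢ)) ≤ 1 + r_bl·(N/m + m − 1), for every μ > 0. -/

import Mathlib

open Matrix

/-- Squared Frobenius norm `‖A‖_F² = trace(Aᵀ A)`. -/
noncomputable def frobSq {m n : Type*} [Fintype m] [Fintype n] (A : Matrix m n ℝ) : ℝ :=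
  Matrix.trace (Aᵀ * A)

/-- `ω(x) = (√x + 1/√x)²/4`, from the Kantorovich inequality. -/
noncomputable def omegaFn (x : ℝ) : ℝ := (Real.sqrt x + 1 / Real.sqrt x) ^ 2 / 4

/-- The `j`-th eigenvalue `λⱼ` of the Laplacian, 1-indexed (with `λⱼ = 0` for `j ≤ 0` since
`λ₁ = 0`, and `0` beyond `N`). -/
noncomputable def eig1 {N : ℕ} (lam : Fin N → ℝ) (j : ℕ) : ℝ :=
  if h : j - 1 < N then lam ⟨j - 1, h⟩ else 0

/-- `B_k(m) = r_bl·(N/m) + ∑_{i=2}^{m} ω(max(1, λ_{k+2−i}/λᵢ))` where `r_bl = ω(λ_k/λ₂)`. -/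
noncomputable def Bbl {N : ℕ} (lam : Fin N → ℝ) (k m : ℕ) : ℝ :=
  omegaFn (eig1 lam k / eig1 lam 2) * ((N : ℝ) / (m : ℝ)) +
    ∑ i ∈ Finset.Icc 2 m, omegaFn (max 1 (eig1 lam (k + 2 - i) / eig1 lam i))


lemma abelFin : ∀ (n : ℕ) (w g h : Fin n → ℝ) (_ : Antitone w) (_ : ∀ i, 0 ≤ w i)
    (_ : ∀ s : ℕ, s ≤ n → ∑ i, (if i.val < s then g i else 0) ≤ ∑ i, (if i.val < s then h i else 0)),
    ∑ i, w i * g i ≤ ∑ i, w i * h i := by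
  have key : ∀ (n : ℕ) (w d : Fin (n+1) → ℝ) (_ : Antitone w) (_ : ∀ i, 0 ≤ w i)
    (_ : ∀ s : ℕ, s ≤ n + 1 → 0 ≤ ∑ i, (if i.val < s then d i else 0)),
    w (Fin.last n) * ∑ i, d i ≤ ∑ i, w i * d i := by
    intro n
    induction n with
    | zero => intro w d _ _ _; simp
    | succ n ih =>
      intro w d hw hw0 H
      have h1 := ih (fun i => w i.castSucc) (fun i => d i.castSucc)
        (fun i j hij => hw (by simpa using hij)) (fun i => hw0 _) (by
          intro s hs
          have := H s (by omega)
          rw [Fin.sum_univ_castSucc] at this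
          have h2 : ¬ (n + 1 < s) := by omega
          simpa [h2] using this)
      have h3 := H (n+1) (by omega)
      rw [Fin.sum_univ_castSucc] at h3
      have h7 : ∀ i : Fin (n+1), i.val < n + 1 := fun i => i.2
      simp only [Fin.val_castSucc, h7, if_true, Fin.val_last, lt_irrefl, if_false, add_zero] at h3
      rw [Fin.sum_univ_castSucc, Fin.sum_univ_castSucc (n := n+1)]
      have h4 : w (Fin.last (n+1)) ≤ w (Fin.last n).castSucc := hw (Fin.le_last _)
      nlinarith [mul_le_mul_of_nonneg_right h4 h3]
  intro n w g h hw hw0 H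
  rcases n with _ | n
  · simp
  have := key n w (fun i => h i - g i) hw hw0 (by
    intro s hs
    have := H s hs
    rw [← sub_nonneg, ← Finset.sum_sub_distrib] at this
    refine this.trans_eq (Finset.sum_congr rfl fun i _ => ?_)
    split_ifs <;> simp)
  have h5 : 0 ≤ ∑ i, (h i - g i) := by
    have := H (n+1) le_rfl
    simp only [Fin.is_lt, if_true] at this
    rw [Finset.sum_sub_distrib]; linarith
  have h6 := mul_nonneg (hw0 (Fin.last n)) h5
  simp only [mul_sub, Finset.sum_sub_distrib] at this h6
  linarith

lemma cardlt (p s : ℕ) : ∑ i : Fin p, (if i.val < s then (1:ℝ) else 0) = (min p s : ℕ) := by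
  rw [Fin.sum_univ_eq_sum_range (fun i => if i < s then (1:ℝ) else 0), ← Finset.sum_filter]
  have : Finset.filter (fun i => i < s) (Finset.range p) = Finset.range (min p s) := by
    ext; simp
  rw [this]; simp

lemma knap (p s : ℕ) (hs : s ≤ p) (a d : Fin p → ℝ) (ha : Monotone a) (ha0 : ∀ i, 0 ≤ a i)
    (hd0 : ∀ i, 0 ≤ d i) (hd1 : ∀ i, d i ≤ 1) (hd : ∑ i, d i ≤ s) :
    ∑ j, d j * a j ≤ ∑ i, (if i.val < s then a (Fin.rev i) else 0) := by
  have h := abelFin p (fun i => a (Fin.rev i)) (fun i => d (Fin.rev i))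
    (fun i => if i.val < s then 1 else 0)
    (fun i j hij => ha (Fin.rev_le_rev.2 hij)) (fun i => ha0 _) (by
      intro t ht
      have e : ∑ i : Fin p, (if i.val < t then (if i.val < s then (1:ℝ) else 0) else 0)
          = (min t s : ℕ) := by
        have := cardlt p (min t s)
        rw [min_eq_right (le_trans (min_le_left _ _) ht)] at this
        rw [← this]
        refine Finset.sum_congr rfl fun i _ => ?_
        by_cases h1 : i.val < t <;> by_cases h2 : i.val < s <;> simp [h1, h2]
      rw [e]
      push_cast
      refine le_min ?_ ?_
      · calc _ ≤ ∑ i : Fin p, (if i.val < t then (1:ℝ) else 0) :=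
              Finset.sum_le_sum fun i _ => by split_ifs <;> simp [hd1]
          _ = t := by rw [cardlt, min_eq_right ht]
      · calc _ ≤ ∑ i : Fin p, d (Fin.rev i) :=
              Finset.sum_le_sum fun i _ => by split_ifs <;> simp [hd0]
          _ = ∑ i, d i := Equiv.sum_comp Fin.revPerm d
          _ ≤ s := hd)
  calc ∑ j, d j * a j = ∑ j, d (Fin.rev j) * a (Fin.rev j) :=
        (Equiv.sum_comp Fin.revPerm (fun j => d j * a j)).symm
    _ = ∑ j, a (Fin.rev j) * d (Fin.rev j) := by simp only [mul_comm]
    _ ≤ _ := h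
    _ = _ := by simp

lemma knapOrth (p s : ℕ) (hs : s ≤ p) (a : Fin p → ℝ) (ha : Monotone a) (ha0 : ∀ i, 0 ≤ a i)
    (O : Matrix (Fin p) (Fin p) ℝ) (h1 : O * Oᵀ = 1) :
    ∑ i, (if i.val < s then ∑ j, (O i j)^2 * a j else 0) ≤
      ∑ i, (if i.val < s then a (Fin.rev i) else 0) := by
  have h2 : Oᵀ * O = 1 := mul_eq_one_comm.1 h1
  have r1 : ∀ i, ∑ j, (O i j)^2 = 1 := fun i => by
    have := congrFun (congrFun h1 i) i
    simpa [Matrix.mul_apply, sq] using this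
  have r2 : ∀ j, ∑ i, (O i j)^2 = 1 := fun i => by
    have := congrFun (congrFun h2 i) i
    simpa [Matrix.mul_apply, sq] using this
  have := knap p s hs a (fun j => ∑ i : Fin p, if i.val < s then (O i j)^2 else 0) ha ha0
    (fun j => Finset.sum_nonneg fun i _ => by split_ifs <;> positivity)
    (fun j => by
      rw [← r2 j]
      exact Finset.sum_le_sum fun i _ => by split_ifs <;> [exact le_rfl; positivity])
    (by
      rw [Finset.sum_comm]
      have e : ∀ i : Fin p, (∑ j, if i.val < s then (O i j)^2 else 0) = if i.val < s then 1 else 0 := by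
        intro i
        split_ifs
        · exact r1 i
        · simp
      simp only [e]
      rw [cardlt, min_eq_right hs])
  refine le_trans (le_of_eq ?_) this
  simp only [Finset.sum_mul]
  rw [Finset.sum_comm]
  refine Finset.sum_congr rfl fun i _ => ?_
  split_ifs <;> simp

lemma kyfan (p t : ℕ) (ht : t ≤ p) (a : Fin p → ℝ) (ha : Monotone a) (ha0 : ∀ i, 0 < a i)
    (R Y : Matrix (Fin p) (Fin p) ℝ) (hR : R * Rᵀ = 1) (hY : Y * Yᵀ = 1) :
    ∑ l, (if l.val < t then
      ∑ i, (1 / a i) * ((R * Matrix.diagonal (fun i => √(a i)) * Y) i l)^2 else 0) ≤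
      ∑ l, (if l.val < t then a (Fin.rev l) / a l else 0) := by
  set Z := R * Matrix.diagonal (fun i => √(a i)) * Y with hZ
  have hd : Matrix.diagonal (fun i => √(a i)) * Matrix.diagonal (fun i => √(a i)) =
      Matrix.diagonal a := by
    rw [Matrix.diagonal_mul_diagonal]
    congr 1; ext i; exact Real.mul_self_sqrt (ha0 i).le
  have hR' : Rᵀ * R = 1 := mul_eq_one_comm.1 hR
  have hY' : Yᵀ * Y = 1 := mul_eq_one_comm.1 hY
  have z1 : ∀ i, ∑ l, (Z i l)^2 = ∑ j, (R i j)^2 * a j := by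
    intro i
    have e : Z * Zᵀ = R * Matrix.diagonal a * Rᵀ := by
      rw [hZ, ← hd]
      simp only [Matrix.transpose_mul, Matrix.diagonal_transpose, Matrix.mul_assoc]
      rw [← Matrix.mul_assoc Y, hY, Matrix.one_mul]
    have := congrFun (congrFun e i) i
    rw [Matrix.mul_apply, Matrix.mul_apply] at this
    simp only [Matrix.mul_diagonal, Matrix.transpose_apply] at this
    calc _ = ∑ j, Z i j * Z i j := by simp only [sq]
      _ = _ := this
      _ = _ := Finset.sum_congr rfl fun j _ => by ring
  have z2 : ∀ l, ∑ i, (Z i l)^2 = ∑ j, (Yᵀ l j)^2 * a j := by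
    intro i
    have e : Zᵀ * Z = Yᵀ * Matrix.diagonal a * Y := by
      rw [hZ, ← hd]
      simp only [Matrix.transpose_mul, Matrix.diagonal_transpose, Matrix.mul_assoc]
      rw [← Matrix.mul_assoc Rᵀ, hR', Matrix.one_mul]
    have := congrFun (congrFun e i) i
    rw [Matrix.mul_apply, Matrix.mul_apply] at this
    simp only [Matrix.mul_diagonal, Matrix.transpose_apply] at this
    calc _ = ∑ j, Z j i * Z j i := by simp only [sq]
      _ = _ := this
      _ = _ := Finset.sum_congr rfl fun j _ => by simp only [Matrix.transpose_apply]; ring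
  have main := abelFin p (fun i => 1 / a i) (fun i => ∑ l, if l.val < t then (Z i l)^2 else 0)
    (fun i => if i.val < t then a (Fin.rev i) else 0)
    (fun i j hij => one_div_le_one_div_of_le (ha0 i) (ha hij))
    (fun i => (one_div_pos.2 (ha0 i)).le) (by
      intro s hs
      rcases le_total s t with hst | hst
      · calc _ ≤ ∑ i, (if i.val < s then ∑ j, (R i j)^2 * a j else 0) := by
              refine Finset.sum_le_sum fun i _ => ?_
              split_ifs
              · rw [← z1]
                exact Finset.sum_le_sum fun l _ => by split_ifs <;> [exact le_rfl; positivity]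
              · exact le_rfl
          _ ≤ _ := knapOrth p s hs a ha (fun i => (ha0 i).le) R hR
          _ = _ := by
              refine Finset.sum_congr rfl fun i _ => ?_
              split_ifs <;> first | rfl | omega
      · calc _ ≤ ∑ i, ∑ l : Fin p, (if l.val < t then (Z i l)^2 else 0) := by
              refine Finset.sum_le_sum fun i _ => ?_
              split_ifs
              · exact le_rfl
              · exact Finset.sum_nonneg fun l _ => by split_ifs <;> positivity
          _ = ∑ l : Fin p, (if l.val < t then ∑ j, (Yᵀ l j)^2 * a j else 0) := by
              rw [Finset.sum_comm]
              refine Finset.sum_congr rfl fun l _ => ?_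
              split_ifs
              · exact z2 l
              · simp
          _ ≤ _ := knapOrth p t ht a ha (fun i => (ha0 i).le) Yᵀ (by simpa using hY')
          _ = _ := by
              refine Finset.sum_congr rfl fun i _ => ?_
              split_ifs <;> first | rfl | omega)
  refine le_trans (le_of_eq ?_) (main.trans (le_of_eq ?_))
  · simp only [Finset.mul_sum]
    rw [Finset.sum_comm]
    refine Finset.sum_congr rfl fun i _ => ?_
    split_ifs <;> simp
  · refine Finset.sum_congr rfl fun i _ => ?_
    split_ifs <;> simp [div_eq_inv_mul]

lemma omega_eq {x : ℝ} (hx : 0 < x) : omegaFn x = (x + 2 + 1 / x) / 4 := by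
  unfold omegaFn
  have h := Real.sq_sqrt hx.le
  have h2 : 0 < √x := Real.sqrt_pos.2 hx
  have : (√x + 1/√x)^2 = √x^2 + 2 + 1/√x^2 := by field_simp; ring
  rw [this, h]

lemma omega_mono {x y : ℝ} (hx : 1 ≤ x) (hxy : x ≤ y) : omegaFn x ≤ omegaFn y := by
  rw [omega_eq (by linarith), omega_eq (by linarith)]
  have hx0 : 0 < x := by linarith
  have hy0 : 0 < y := by linarith
  have : 1/x - 1/y ≤ y - x := by
    rw [div_sub_div _ _ hx0.ne' hy0.ne', div_le_iff₀ (by positivity)]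
    nlinarith [mul_nonneg (sub_nonneg.2 hxy) (by nlinarith : 0 ≤ x*y - 1)]
  linarith

lemma omega_one_le {x : ℝ} (hx : 1 ≤ x) : 1 ≤ omegaFn x := by
  have := omega_mono le_rfl hx
  rwa [omega_eq one_pos, show ((1:ℝ)+2+1/1)/4 = 1 by norm_num] at this

lemma omega_tangent {x v : ℝ} (hx : 0 < x) (hv : 0 < v) :
    omegaFn v + (1 - 1/v^2)/4 * (x - v) ≤ omegaFn x := by
  rw [omega_eq hx, omega_eq hv]
  have : (x + 2 + 1/x)/4 - ((v+2+1/v)/4 + (1 - 1/v^2)/4 * (x - v)) = (x-v)^2/(4*x*v^2) := by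
    field_simp; ring
  have h : 0 ≤ (x-v)^2/(4*x*v^2) := by positivity
  linarith

lemma omega_maj (q : ℕ) (v x : Fin q → ℝ) (hv : Antitone v) (hv1 : ∀ i, 1 ≤ v i) (hx : ∀ i, 0 < x i)
    (H : ∀ s : ℕ, s ≤ q → ∑ i, (if i.val < s then v i else 0) ≤ ∑ i, (if i.val < s then x i else 0)) :
    ∑ i, omegaFn (v i) ≤ ∑ i, omegaFn (x i) := by
  have h := abelFin q (fun i => (1 - 1/(v i)^2)/4) v x (by
    intro i j hij
    have h1 := hv hij
    have := hv1 j
    have : 1/(v i)^2 ≤ 1/(v j)^2 := one_div_le_one_div_of_le (by positivity) (by gcongr)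
    try simp only
    linarith) (by
    intro i
    have h1 := hv1 i
    have : 1/(v i)^2 ≤ 1 := by
      rw [div_le_one (by positivity)]; nlinarith
    try simp only
    linarith) H
  have : ∑ i, (omegaFn (v i) + (1 - 1/(v i)^2)/4 * (x i - v i)) ≤ ∑ i, omegaFn (x i) :=
    Finset.sum_le_sum fun i _ => omega_tangent (hx i) (lt_of_lt_of_le one_pos (hv1 i))
  simp only [mul_sub, Finset.sum_add_distrib, Finset.sum_sub_distrib] at this
  linarith

lemma sorted_spec (p : ℕ) (A : Matrix (Fin p) (Fin p) ℝ) (hA : Aᵀ = A) :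
    ∃ (Y : Matrix (Fin p) (Fin p) ℝ) (v : Fin p → ℝ), Antitone v ∧ Y * Yᵀ = 1 ∧ Yᵀ * Y = 1 ∧
      A = Y * Matrix.diagonal v * Yᵀ := by
  have hH : A.IsHermitian := by
    rw [Matrix.IsHermitian, Matrix.conjTranspose_eq_transpose_of_trivial, hA]
  have hs := hH.spectral_theorem
  rw [Unitary.conjStarAlgAut_apply] at hs
  set U : Matrix (Fin p) (Fin p) ℝ := hH.eigenvectorUnitary.1 with hU
  have hUU : U * Uᵀ = 1 := by
    have := Unitary.coe_mul_star_self hH.eigenvectorUnitary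
    rwa [Unitary.coe_star, Matrix.star_eq_conjTranspose, Matrix.conjTranspose_eq_transpose_of_trivial] at this
  set σ := Tuple.sort (fun i => - hH.eigenvalues i)
  have hσ := Tuple.monotone_sort (fun i => - hH.eigenvalues i)
  have h1 : U.submatrix id σ * (U.submatrix id σ)ᵀ = 1 := by
    rw [Matrix.transpose_submatrix, Matrix.submatrix_mul_equiv, hUU]; simp
  refine ⟨U.submatrix id σ, hH.eigenvalues ∘ σ, ?_, h1, mul_eq_one_comm.1 h1, ?_⟩
  · intro i j hij
    have := hσ hij
    simp only [Function.comp] at this ⊢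
    linarith
  · rw [Matrix.transpose_submatrix, show Matrix.diagonal (hH.eigenvalues ∘ σ) =
      (Matrix.diagonal hH.eigenvalues).submatrix σ σ from (by simp [Matrix.submatrix_diagonal_equiv]),
      Matrix.submatrix_mul_equiv, Matrix.submatrix_mul_equiv]
    conv_lhs => rw [hs]
    simp only [Matrix.submatrix_id_id, Matrix.star_eq_conjTranspose,
      Matrix.conjTranspose_eq_transpose_of_trivial]
    rfl

lemma sum_castLE {q p : ℕ} (h : q ≤ p) (f : Fin p → ℝ) :
    ∑ i : Fin q, f (Fin.castLE h i) = ∑ l : Fin p, if l.val < q then f l else 0 := by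
  obtain ⟨d, rfl⟩ := Nat.exists_eq_add_of_le h
  rw [Fin.sum_univ_add]
  simp [Fin.castLE, Fin.castAdd]

lemma recip_sum {p : ℕ} (B Y : Matrix (Fin p) (Fin p) ℝ) (v : Fin p → ℝ) (hB : B * B = 1)
    (hY : Y * Yᵀ = 1) (hN : Yᵀ * (Bᵀ * B) * Y = Matrix.diagonal v) :
    (∀ i, 0 < v i) ∧ ∀ g : ℝ → ℝ, ∑ i, g (v i) = ∑ i, g (1 / v i) := by
  have hY' : Yᵀ * Y = 1 := mul_eq_one_comm.1 hY
  have hBt : Bᵀ * Bᵀ = 1 := by rw [← Matrix.transpose_mul, hB, Matrix.transpose_one]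
  set K := Yᵀ * (B * Bᵀ) * Y with hK
  have h1 : Matrix.diagonal v * K = 1 := by
    rw [← hN, hK]
    simp only [Matrix.mul_assoc]
    rw [← Matrix.mul_assoc Y, hY, Matrix.one_mul, ← Matrix.mul_assoc B B, hB, Matrix.one_mul,
      ← Matrix.mul_assoc Bᵀ Bᵀ, hBt, Matrix.one_mul, hY']
  have hne : ∀ i, v i ≠ 0 := by
    intro i h
    have := congrFun (congrFun h1 i) i
    simp [Matrix.diagonal_mul, h] at this
  have hpos : ∀ i, 0 < v i := by
    intro i
    refine lt_of_le_of_ne ?_ (hne i).symm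
    have e : (B * Y)ᵀ * (B * Y) = Matrix.diagonal v := by
      rw [← hN, Matrix.transpose_mul]; simp only [Matrix.mul_assoc]
    have := congrFun (congrFun e i) i
    rw [Matrix.mul_apply, Matrix.diagonal_apply_eq] at this
    rw [← this]
    exact Finset.sum_nonneg fun j _ => mul_self_nonneg _
  refine ⟨hpos, ?_⟩
  have hKd : K = Matrix.diagonal (fun i => 1 / v i) := by
    have h2 : Matrix.diagonal (fun i => 1 / v i) * Matrix.diagonal v = 1 := by
      rw [Matrix.diagonal_mul_diagonal, ← Matrix.diagonal_one]
      congr 1; ext i; field_simp [hne i]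
    calc K = (Matrix.diagonal (fun i => 1 / v i) * Matrix.diagonal v) * K := by rw [h2, Matrix.one_mul]
      _ = _ := by rw [Matrix.mul_assoc, h1, Matrix.mul_one]
  have hc : (Matrix.diagonal v).charpoly = (Matrix.diagonal (fun i => 1 / v i)).charpoly := by
    have c : ∀ Q : Matrix (Fin p) (Fin p) ℝ, (Yᵀ * Q * Y).charpoly = Q.charpoly := by
      intro Q
      rw [Matrix.charpoly_mul_comm, ← Matrix.mul_assoc, hY, Matrix.one_mul]
    rw [← hN, ← hKd, hK, c, c, Matrix.charpoly_mul_comm]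
  have cd : ∀ d : Fin p → ℝ, (Matrix.diagonal d).charpoly.roots = Finset.univ.val.map d := by
    intro d
    have : (Matrix.diagonal d).charpoly = (Finset.univ.val.map
        (fun i => Polynomial.X - Polynomial.C (d i))).prod := by
      rw [Matrix.charpoly_diagonal]; rfl
    rw [this, ← Polynomial.roots_multiset_prod_X_sub_C (Finset.univ.val.map d), Multiset.map_map]
    rfl
  have hm : Finset.univ.val.map v = Finset.univ.val.map (fun i => 1 / v i) := by
    rw [← cd, ← cd, hc]
  intro g
  have := congrArg (fun s => (Multiset.map g s).sum) hm
  simp only [Multiset.map_map] at this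
  exact this

lemma projcore (p r : ℕ) (a : Fin p → ℝ) (ha : Monotone a) (ha0 : ∀ i, 0 < a i)
    (T : Matrix (Fin p) (Fin p) ℝ) (hT : Tᵀ = T) (hTT : T * T = T) (hr : T.rank ≤ r) :
    ∑ i, ∑ j, (T i j)^2 * (a j / a i - 1) ≤
      ∑ l : Fin p, if l.val < r then omegaFn (max 1 (a (Fin.rev l) / a l)) - 1 else 0 := by
  obtain ⟨R, hRd⟩ : ∃ R : Matrix (Fin p) (Fin p) ℝ, R = (2:ℝ) • T - 1 := ⟨_, rfl⟩
  have hRt : Rᵀ = R := by rw [hRd]; simp [hT]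
  have hRR : R * R = 1 := by
    rw [hRd]; simp only [Matrix.mul_sub, Matrix.sub_mul, Matrix.smul_mul, Matrix.mul_smul, hTT,
      Matrix.mul_one, Matrix.one_mul]
    module
  obtain ⟨D, hD⟩ : ∃ D, D = Matrix.diagonal (fun i => √(a i)) := ⟨_, rfl⟩
  obtain ⟨Di, hDi⟩ : ∃ D, D = Matrix.diagonal (fun i => (√(a i))⁻¹) := ⟨_, rfl⟩
  have hs : ∀ i, 0 < √(a i) := fun i => Real.sqrt_pos.2 (ha0 i)
  have hDD : D * Di = 1 := by
    rw [hD, hDi, Matrix.diagonal_mul_diagonal, ← Matrix.diagonal_one]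
    congr 1; ext i; exact mul_inv_cancel₀ (hs i).ne'
  have hDD' : Di * D = 1 := mul_eq_one_comm.1 hDD
  obtain ⟨B, hB⟩ : ∃ B, B = Di * R * D := ⟨_, rfl⟩
  have hBB : B * B = 1 := by
    rw [hB]; simp only [Matrix.mul_assoc]
    rw [← Matrix.mul_assoc D Di, hDD, Matrix.one_mul, ← Matrix.mul_assoc R R, hRR, Matrix.one_mul, hDD']
  obtain ⟨Y, v, hv, hY, hY', hNs⟩ := sorted_spec p (Bᵀ * B) (by simp [Matrix.transpose_mul])
  have hN : Yᵀ * (Bᵀ * B) * Y = Matrix.diagonal v := by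
    rw [hNs]; simp only [Matrix.mul_assoc]
    rw [hY', Matrix.mul_one, ← Matrix.mul_assoc, hY', Matrix.one_mul]
  obtain ⟨hv0, hrec⟩ := recip_sum B Y v hBB hY hN
  have hBij : ∀ i j, B i j = (√(a i))⁻¹ * R i j * √(a j) := by
    intro i j; rw [hB, hDi, hD, Matrix.mul_diagonal, Matrix.diagonal_mul]
  have hF : 4 * ∑ i, ∑ j, (T i j)^2 * (a j / a i - 1) = ∑ i, (v i - 1) := by
    have t1 : ∑ i, v i = ∑ i, ∑ j, (B i j)^2 := by
      have : Matrix.trace (Matrix.diagonal v) = Matrix.trace (Bᵀ * B) := by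
        rw [← hN, Matrix.trace_mul_comm, ← Matrix.mul_assoc, hY, Matrix.one_mul]
      rw [Matrix.trace_diagonal] at this
      rw [this, Finset.sum_comm]
      simp only [Matrix.trace, Matrix.diag, Matrix.mul_apply, Matrix.transpose_apply, sq]
    have t2 : ∑ i : Fin p, (1:ℝ) = ∑ i, ∑ j, (R i j)^2 := by
      refine Finset.sum_congr rfl fun i _ => ?_
      have := congrFun (congrFun hRR i) i
      rw [Matrix.mul_apply, Matrix.one_apply_eq] at this
      rw [← this]
      refine Finset.sum_congr rfl fun j _ => ?_
      rw [sq]; congr 1; conv_lhs => rw [← hRt]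
      rfl
    rw [Finset.sum_sub_distrib, t1, t2, ← Finset.sum_sub_distrib, Finset.mul_sum]
    refine Finset.sum_congr rfl fun i _ => ?_
    rw [← Finset.sum_sub_distrib, Finset.mul_sum]
    refine Finset.sum_congr rfl fun j _ => ?_
    have e1 : (B i j)^2 = (R i j)^2 * (a j / a i) := by
      rw [hBij, mul_pow, mul_pow, inv_pow, Real.sq_sqrt (ha0 i).le, Real.sq_sqrt (ha0 j).le]
      field_simp
    rw [e1]
    by_cases hij : i = j
    · subst hij; rw [div_self (ha0 i).ne']; ring
    · have : R i j = 2 * T i j := by rw [hRd]; simp [hij]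
      rw [this]; ring
  have hF2 : ∑ i, (v i - 1) = 4 * ∑ i, (if 1 < v i then omegaFn (v i) - 1 else 0) := by
    have h1 : ∑ i, (v i - 1) = ∑ i, (if 1 < v i then v i - 1 else 0) +
        ∑ i, (if v i < 1 then v i - 1 else 0) := by
      rw [← Finset.sum_add_distrib]
      refine Finset.sum_congr rfl fun i _ => ?_
      rcases lt_trichotomy (v i) 1 with h | h | h
      · simp [h, h.le.not_gt]
      · simp [h]
      · simp [h, h.le.not_gt]
    rw [h1, hrec (fun x => if x < 1 then x - 1 else 0), ← Finset.sum_add_distrib, Finset.mul_sum]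
    refine Finset.sum_congr rfl fun i _ => ?_
    have : 1 / v i < 1 ↔ 1 < v i := by rw [div_lt_one (hv0 i)]
    simp only [this]
    split_ifs
    · rw [omega_eq (hv0 i)]; ring
    · simp
  obtain ⟨q, hq⟩ : ∃ q, q = (Finset.univ.filter (fun i => 1 < v i)).card := ⟨_, rfl⟩
  have hqi : ∀ l : Fin p, 1 < v l ↔ l.val < q := by
    intro l
    constructor
    · intro h
      have : Finset.Iic l ⊆ Finset.univ.filter (fun i => 1 < v i) := by
        intro i hi
        simp only [Finset.mem_Iic] at hi
        simp only [Finset.mem_filter, Finset.mem_univ, true_and]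
        exact lt_of_lt_of_le h (hv hi)
      have := Finset.card_le_card this
      rw [Fin.card_Iic] at this; omega
    · intro h
      by_contra h2
      have : Finset.univ.filter (fun i => 1 < v i) ⊆ Finset.Iio l := by
        intro i hi
        simp only [Finset.mem_filter, Finset.mem_univ, true_and] at hi
        rw [Finset.mem_Iio]
        by_contra h3
        exact h2 (lt_of_lt_of_le hi (hv (not_lt.1 h3)))
      have := Finset.card_le_card this
      rw [Fin.card_Iio] at this; omega
  have hqp : 2 * q ≤ p := by
    have h1 := hrec (fun x => if 1 < x then 1 else 0)
    have h3 : (q:ℝ) = ∑ i, (if 1 < v i then (1:ℝ) else 0) := by rw [hq]; simp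
    have h2 : (q:ℝ) + q ≤ p := by
      calc (q:ℝ) + q = ∑ i, (if 1 < v i then (1:ℝ) else 0) + ∑ i, (if 1 < 1 / v i then (1:ℝ) else 0) := by
            rw [← h1, h3]
        _ ≤ ∑ i : Fin p, 1 := by
            rw [← Finset.sum_add_distrib]
            refine Finset.sum_le_sum fun i _ => ?_
            have : 1 < 1 / v i ↔ v i < 1 := by rw [lt_div_iff₀ (hv0 i), one_mul]
            simp only [this]
            split_ifs <;> linarith
        _ = p := by simp
    have : ((2 * q : ℕ) : ℝ) ≤ p := by push_cast; linarith
    exact_mod_cast this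
  have hqp' : q ≤ p := by omega
  have hqr : q ≤ r := by
    obtain ⟨V, hV⟩ : ∃ V, V = Y.submatrix id (Fin.castLE hqp') := ⟨_, rfl⟩
    have hVV : Vᵀ * V = 1 := by
      have := congrArg (fun M => M.submatrix (Fin.castLE hqp') (Fin.castLE hqp')) hY'
      try simp only at this
      rw [Matrix.submatrix_mul (he₂ := Function.bijective_id),
        Matrix.submatrix_one _ (Fin.castLE_injective hqp')] at this
      rw [hV, ← this]; rfl
    have hVN : Vᵀ * (Bᵀ * B) * V = Matrix.diagonal (fun i => v (Fin.castLE hqp' i)) := by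
      have := congrArg (fun M => M.submatrix (Fin.castLE hqp') (Fin.castLE hqp')) hN
      try simp only at this
      rw [Matrix.submatrix_mul (e₂ := id) (he₂ := Function.bijective_id),
        Matrix.submatrix_mul (e₂ := id) (he₂ := Function.bijective_id),
        Matrix.submatrix_diagonal _ _ (Fin.castLE_injective hqp')] at this
      rw [hV]; exact this
    have hinj : Function.Injective ((Di * T * D * V).mulVecLin) := by
      rw [← LinearMap.ker_eq_bot, LinearMap.ker_eq_bot']
      intro c hc
      rw [Matrix.mulVecLin_apply] at hc
      have hBE : B = (2:ℝ) • (Di * T * D) - 1 := by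
        rw [hB, hRd, Matrix.mul_sub, Matrix.sub_mul, Matrix.mul_one, hDD', Matrix.mul_smul,
          Matrix.smul_mul]
      have hBV : (B * V).mulVec c = - V.mulVec c := by
        rw [hBE, Matrix.sub_mul, Matrix.smul_mul, Matrix.sub_mulVec, Matrix.smul_mulVec, hc,
          Matrix.one_mul]; simp
      have e1 : (B * V).mulVec c ⬝ᵥ (B * V).mulVec c = V.mulVec c ⬝ᵥ V.mulVec c := by
        rw [hBV]; simp
      have e2 : ∀ W : Matrix (Fin p) (Fin q) ℝ, W.mulVec c ⬝ᵥ W.mulVec c = c ⬝ᵥ (Wᵀ * W).mulVec c := by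
        intro W
        rw [← Matrix.mulVec_mulVec, Matrix.dotProduct_mulVec c, Matrix.vecMul_transpose]
      rw [e2, e2, hVV, Matrix.transpose_mul, Matrix.mul_assoc, ← Matrix.mul_assoc Bᵀ,
        ← Matrix.mul_assoc Vᵀ, hVN, Matrix.one_mulVec] at e1
      simp only [dotProduct, Matrix.mulVec_diagonal] at e1
      rw [← sub_eq_zero, ← Finset.sum_sub_distrib, Finset.sum_eq_zero_iff_of_nonneg] at e1
      · ext i
        have h1 := e1 i (Finset.mem_univ _)
        have h2 := (hqi (Fin.castLE hqp' i)).2 i.2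
        have h3 : (v (Fin.castLE hqp' i) - 1) * (c i * c i) = 0 := by linarith
        rcases mul_eq_zero.1 h3 with h | h
        · linarith
        · simpa using h
      · intro i _
        have h2 := (hqi (Fin.castLE hqp' i)).2 i.2
        nlinarith [mul_self_nonneg (c i)]
    have h1 : (Di * T * D * V).rank = q := by
      rw [Matrix.rank, LinearMap.finrank_range_of_inj hinj]; simp
    calc q = (Di * T * D * V).rank := h1.symm
      _ ≤ (Di * T * D).rank := Matrix.rank_mul_le_left _ _
      _ ≤ (Di * T).rank := Matrix.rank_mul_le_left _ _
      _ ≤ T.rank := Matrix.rank_mul_le_right _ _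
      _ ≤ r := hr
  have hvl : ∀ l, v l = ∑ i, (1 / a i) * ((R * Matrix.diagonal (fun i => √(a i)) * Y) i l)^2 := by
    intro l
    have e : (B * Y)ᵀ * (B * Y) = Matrix.diagonal v := by
      rw [← hN, Matrix.transpose_mul]; simp only [Matrix.mul_assoc]
    have := congrFun (congrFun e l) l
    rw [Matrix.mul_apply, Matrix.diagonal_apply_eq] at this
    rw [← this]
    refine Finset.sum_congr rfl fun i _ => ?_
    have e2 : (B * Y) i l = (√(a i))⁻¹ * (R * Matrix.diagonal (fun i => √(a i)) * Y) i l := by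
      rw [hB, ← hD, Matrix.mul_assoc, Matrix.mul_assoc, hDi, Matrix.diagonal_mul, Matrix.mul_assoc]
    rw [Matrix.transpose_apply, e2]
    have := Real.sq_sqrt (ha0 i).le
    rw [mul_mul_mul_comm, ← sq, ← sq, inv_pow, this, one_div]
  have hmaj := omega_maj q (fun i => v (Fin.castLE hqp' i))
    (fun i => a (Fin.rev (Fin.castLE hqp' i)) / a (Fin.castLE hqp' i))
    (fun i j hij => hv (by simpa using hij)) (fun i => ((hqi _).2 i.2).le)
    (fun i => div_pos (ha0 _) (ha0 _)) (by
      intro s hs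
      have h1 := sum_castLE hqp' (fun l => if l.val < s then v l else 0)
      have h2 := sum_castLE hqp' (fun l => if l.val < s then a (Fin.rev l) / a l else 0)
      have e3 : ∀ f : Fin p → ℝ, (∑ l : Fin p, if l.val < q then (if l.val < s then f l else 0) else 0)
          = ∑ l : Fin p, if l.val < s then f l else 0 := by
        intro f
        refine Finset.sum_congr rfl fun l _ => ?_
        split_ifs <;> first | rfl | omega
      rw [e3] at h1 h2
      simp only [Fin.val_castLE] at h1 h2
      rw [h1, h2]
      have := kyfan p s (by omega) a ha ha0 R Y (by rw [hRt, hRR]) hY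
      simp only [← hvl] at this
      exact this)
  rw [sum_castLE hqp' (fun l => omegaFn (v l)),
    sum_castLE hqp' (fun l => omegaFn (a (Fin.rev l) / a l))] at hmaj
  have hfin : ∑ i, ∑ j, (T i j)^2 * (a j / a i - 1) =
      ∑ i, (if i.val < q then omegaFn (v i) - 1 else 0) := by
    simp only [hqi] at hF2
    linarith
  rw [hfin]
  have split : ∀ f : Fin p → ℝ, ∑ i : Fin p, (if i.val < q then f i - 1 else 0) =
      ∑ i : Fin p, (if i.val < q then f i else 0) - ∑ i : Fin p, (if i.val < q then (1:ℝ) else 0) := by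
    intro f
    rw [← Finset.sum_sub_distrib]
    refine Finset.sum_congr rfl fun i _ => ?_
    split_ifs <;> simp
  calc _ ≤ ∑ i : Fin p, (if i.val < q then omegaFn (a (Fin.rev i) / a i) - 1 else 0) := by
        rw [split (fun i => omegaFn (v i)), split (fun i => omegaFn (a (Fin.rev i) / a i))]
        linarith
    _ ≤ _ := by
        refine Finset.sum_le_sum fun i _ => ?_
        by_cases h : i.val < q
        · rw [if_pos h, if_pos (by omega)]
          rw [max_eq_right]
          rw [le_div_iff₀ (ha0 i), one_mul]
          apply ha
          rw [Fin.le_def, Fin.val_rev]; omega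
        · rw [if_neg h]
          split_ifs
          · linarith [omega_one_le (le_max_left 1 (a (Fin.rev i) / a i))]
          · exact le_rfl

lemma spec01 (p r : ℕ) (X : Matrix (Fin p) (Fin p) ℝ)
    (hX0 : X.PosSemidef) (hX1 : (1 - X).PosSemidef) (hr : X.rank ≤ r) :
    ∃ (Y : Matrix (Fin p) (Fin p) ℝ) (v : Fin p → ℝ), Y * Yᵀ = 1 ∧ Yᵀ * Y = 1 ∧
      X = Y * Matrix.diagonal v * Yᵀ ∧ (∀ i, 0 ≤ v i) ∧ (∀ i, v i ≤ 1) ∧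
      (Finset.univ.filter (fun i => v i ≠ 0)).card ≤ r := by
  have hXt : Xᵀ = X := by
    have := hX0.1
    rwa [Matrix.IsHermitian, Matrix.conjTranspose_eq_transpose_of_trivial] at this
  obtain ⟨Y, v, -, hY, hY', hX⟩ := sorted_spec p X hXt
  have hd : Yᵀ * X * Y = Matrix.diagonal v := by
    rw [hX]; simp only [Matrix.mul_assoc]
    rw [hY', Matrix.mul_one, ← Matrix.mul_assoc, hY', Matrix.one_mul]
  refine ⟨Y, v, hY, hY', hX, ?_, ?_, ?_⟩
  · intro i
    have := (hX0.conjTranspose_mul_mul_same Y).diag_nonneg (i := i)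
    rwa [Matrix.conjTranspose_eq_transpose_of_trivial, hd, Matrix.diagonal_apply_eq] at this
  · intro i
    have := (hX1.conjTranspose_mul_mul_same Y).diag_nonneg (i := i)
    rw [Matrix.conjTranspose_eq_transpose_of_trivial, Matrix.mul_sub, Matrix.sub_mul, hd,
      Matrix.mul_one, hY', Matrix.sub_apply, Matrix.diagonal_apply_eq, Matrix.one_apply_eq] at this
    linarith
  · have h1 : (Matrix.diagonal v).rank ≤ r := by
      rw [← hd]
      exact ((Matrix.rank_mul_le_left _ _).trans (Matrix.rank_mul_le_right _ _)).trans hr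
    rw [Matrix.rank_diagonal, Fintype.card_subtype] at h1
    exact h1

lemma core (p r : ℕ) (a : Fin p → ℝ) (ha : Monotone a) (ha0 : ∀ i, 0 < a i)
    (X : Matrix (Fin p) (Fin p) ℝ) (hX0 : X.PosSemidef) (hX1 : (1 - X).PosSemidef)
    (hr : X.rank ≤ r) :
    ∑ i, ∑ j, (X i j)^2 * (a j / a i - 1) ≤
      ∑ l : Fin p, if l.val < r then omegaFn (max 1 (a (Fin.rev l) / a l)) - 1 else 0 := by
  obtain ⟨Y, v, hY, hY', hX, hv0, hv1, hc⟩ := spec01 p r X hX0 hX1 hr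
  obtain ⟨Q, hQ⟩ : ∃ Q : (Fin p → ℝ) → Matrix (Fin p) (Fin p) ℝ,
    Q = fun θ => Y * Matrix.diagonal θ * Yᵀ := ⟨_, rfl⟩
  have hQt : ∀ θ, (Q θ)ᵀ = Q θ := by
    intro θ; rw [hQ]; simp [Matrix.transpose_mul, Matrix.mul_assoc]
  have hsym : ∀ θ, ∑ i, ∑ j, (Q θ i j)^2 * (a j / a i - 1) =
      ∑ i, ∑ j, (Q θ i j)^2 * ((a j / a i + a i / a j - 2) / 2) := by
    intro θ
    have e : ∑ i, ∑ j, (Q θ i j)^2 * (a j / a i - 1) = ∑ i, ∑ j, (Q θ i j)^2 * (a i / a j - 1) := by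
      rw [Finset.sum_comm]
      refine Finset.sum_congr rfl fun i _ => Finset.sum_congr rfl fun j _ => ?_
      have : Q θ j i = Q θ i j := congrFun (congrFun (hQt θ) i) j
      rw [this]
    have e2 : ∑ i, ∑ j, (Q θ i j)^2 * ((a j / a i + a i / a j - 2) / 2) =
       (∑ i, ∑ j, (Q θ i j)^2 * (a j / a i - 1) + ∑ i, ∑ j, (Q θ i j)^2 * (a i / a j - 1)) / 2 := by
      rw [← Finset.sum_add_distrib, Finset.sum_div]
      refine Finset.sum_congr rfl fun i _ => ?_
      rw [← Finset.sum_add_distrib, Finset.sum_div]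
      refine Finset.sum_congr rfl fun j _ => ?_
      ring
    rw [e2, ← e]; ring
  have hlin : ∀ (x y : Fin p → ℝ) (s t : ℝ) (i j), Q (s • x + t • y) i j = s * Q x i j + t * Q y i j := by
    intro x y s t i j
    have : Q (s • x + t • y) = s • Q x + t • Q y := by
      rw [hQ]
      have : Matrix.diagonal (s • x + t • y) = s • Matrix.diagonal x + t • Matrix.diagonal y := by
        rw [← Matrix.diagonal_smul, ← Matrix.diagonal_smul, Matrix.diagonal_add]; rfl
      simp only [this, Matrix.mul_add, Matrix.add_mul, Matrix.mul_smul, Matrix.smul_mul]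
    rw [this]; simp
  have hconv : ConvexOn ℝ Set.univ
      (fun θ => ∑ i, ∑ j, (Q θ i j)^2 * ((a j / a i + a i / a j - 2) / 2)) := by
    refine ⟨convex_univ, ?_⟩
    intro x _ y _ s t hs ht hst
    simp only [smul_eq_mul, Finset.mul_sum]
    rw [← Finset.sum_add_distrib]
    refine Finset.sum_le_sum fun i _ => ?_
    rw [← Finset.sum_add_distrib]
    refine Finset.sum_le_sum fun j _ => ?_
    have hw : 0 ≤ (a j / a i + a i / a j - 2) / 2 := by
      have h1 := ha0 i
      have h2 := ha0 j
      have : (a j / a i + a i / a j - 2) / 2 = (a i - a j)^2 / (2 * a i * a j) := by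
        field_simp; ring
      rw [this]; positivity
    rw [hlin, ← mul_assoc, ← mul_assoc, ← add_mul]
    refine mul_le_mul_of_nonneg_right ?_ hw
    have : t = 1 - s := by linarith
    subst this
    nlinarith [mul_nonneg (mul_nonneg hs ht) (sq_nonneg (Q x i j - Q y i j))]
  have hmem : v ∈ convexHull ℝ (Set.pi Set.univ (fun i => if v i = 0 then ({0} : Set ℝ) else {0, 1})) := by
    rw [convexHull_pi]
    intro i _
    by_cases h : v i = 0
    · simp [h]
    · simp only [h, if_false]
      rw [convexHull_pair, segment_eq_Icc zero_le_one]
      exact ⟨hv0 i, hv1 i⟩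
  obtain ⟨θ, hθ, hle⟩ := hconv.exists_ge_of_mem_convexHull (Set.subset_univ _) hmem
  have hθ01 : ∀ i, θ i * θ i = θ i ∧ (v i = 0 → θ i = 0) := by
    intro i
    have := hθ i (Set.mem_univ i)
    by_cases h : v i = 0
    · simp [h] at this; simp [this]
    · simp [h] at this
      rcases this with h' | h' <;> simp [h', h]
  rw [← hsym, ← hsym] at hle
  have hXQ : X = Q v := by rw [hX, hQ]
  rw [hXQ]
  refine hle.trans (projcore p r a ha ha0 (Q θ) (hQt θ) ?_ ?_)
  · rw [hQ]
    simp only [Matrix.mul_assoc]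
    rw [← Matrix.mul_assoc Yᵀ Y, hY', Matrix.one_mul, ← Matrix.mul_assoc (Matrix.diagonal θ),
      Matrix.diagonal_mul_diagonal]
    simp only [fun i => (hθ01 i).1]
  · calc (Q θ).rank ≤ (Matrix.diagonal θ).rank := by
          rw [hQ]
          exact (Matrix.rank_mul_le_left _ _).trans (Matrix.rank_mul_le_right _ _)
      _ = (Finset.univ.filter (fun i => θ i ≠ 0)).card := by
          rw [Matrix.rank_diagonal, Fintype.card_subtype]
      _ ≤ (Finset.univ.filter (fun i => v i ≠ 0)).card := by
          apply Finset.card_le_card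
          intro i
          simp only [Finset.mem_filter, Finset.mem_univ, true_and]
          exact fun h h2 => h ((hθ01 i).2 h2)
      _ ≤ r := hc

lemma bandcore (n p r : ℕ) (hpn : p ≤ n) (b : Fin n → ℝ) (hb : Monotone b) (hb0 : ∀ i, 0 < b i)
    (T : Matrix (Fin n) (Fin n) ℝ) (hT0 : T.PosSemidef) (hT1 : (1 - T).PosSemidef)
    (hr : T.rank ≤ r) :
    ∑ i, ∑ j : Fin p, (T i (Fin.castLE hpn j))^2 * (b (Fin.castLE hpn j) / b i) ≤
      r + ∑ l : Fin p, if l.val < r then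
        omegaFn (max 1 (b (Fin.castLE hpn (Fin.rev l)) / b (Fin.castLE hpn l))) - 1 else 0 := by
  have hF : ∑ i, ∑ j, (T i j)^2 ≤ r := by
    obtain ⟨Y, v, hY, hY', hX, hv0, hv1, hc⟩ := spec01 n r T hT0 hT1 hr
    have hTt : Tᵀ = T := by
      have := hT0.1
      rwa [Matrix.IsHermitian, Matrix.conjTranspose_eq_transpose_of_trivial] at this
    have e1 : ∑ i, ∑ j, (T i j)^2 = Matrix.trace (T * Tᵀ) := by
      simp only [Matrix.trace, Matrix.diag, Matrix.mul_apply, Matrix.transpose_apply, sq]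
    have e2 : T * T = Y * (Matrix.diagonal v * Matrix.diagonal v) * Yᵀ := by
      rw [hX]; simp only [Matrix.mul_assoc]
      rw [← Matrix.mul_assoc Yᵀ Y, hY', Matrix.one_mul]
    rw [e1, hTt, e2, Matrix.trace_mul_comm, ← Matrix.mul_assoc, hY', Matrix.one_mul,
      Matrix.diagonal_mul_diagonal, Matrix.trace_diagonal]
    calc ∑ i, v i * v i ≤ ∑ i, (if v i ≠ 0 then (1:ℝ) else 0) := by
          refine Finset.sum_le_sum fun i _ => ?_
          by_cases h : v i = 0
          · simp [h]
          · rw [if_pos h]; nlinarith [hv0 i, hv1 i]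
      _ = ((Finset.univ.filter (fun i => v i ≠ 0)).card : ℝ) := by rw [Finset.sum_boole]
      _ ≤ r := by exact_mod_cast hc
  have hF2 : ∑ i, ∑ j : Fin p, (T i (Fin.castLE hpn j))^2 ≤ r := by
    refine le_trans (Finset.sum_le_sum fun i _ => ?_) hF
    rw [sum_castLE hpn (fun j => (T i j)^2)]
    exact Finset.sum_le_sum fun j _ => by split_ifs <;> [exact le_rfl; positivity]
  have hc := core p r (fun i => b (Fin.castLE hpn i)) (fun i j hij => hb (by simpa using hij))
    (fun i => hb0 _) (T.submatrix (Fin.castLE hpn) (Fin.castLE hpn)) (hT0.submatrix _) (by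
      have := hT1.submatrix (Fin.castLE hpn)
      rwa [Matrix.submatrix_sub, Pi.sub_apply, Pi.sub_apply,
        Matrix.submatrix_one _ (Fin.castLE_injective hpn)] at this) (by
      refine le_trans ?_ hr
      exact Matrix.rank_submatrix_le _ _ _)
  have hG : ∑ i, ∑ j : Fin p, (T i (Fin.castLE hpn j))^2 * (b (Fin.castLE hpn j) / b i - 1) ≤
      ∑ i : Fin p, ∑ j : Fin p, (T (Fin.castLE hpn i) (Fin.castLE hpn j))^2 *
        (b (Fin.castLE hpn j) / b (Fin.castLE hpn i) - 1) := by
    rw [sum_castLE hpn (fun i => ∑ j : Fin p, (T i (Fin.castLE hpn j))^2 *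
        (b (Fin.castLE hpn j) / b i - 1))]
    refine Finset.sum_le_sum fun i _ => ?_
    split_ifs with h
    · exact le_rfl
    · refine Finset.sum_nonpos fun j _ => ?_
      refine mul_nonpos_of_nonneg_of_nonpos (sq_nonneg _) ?_
      rw [sub_nonpos, div_le_one (hb0 i)]
      apply hb
      rw [Fin.le_def]; simp; omega
  simp only [Matrix.submatrix_apply] at hc
  have hsplit : ∑ i, ∑ j : Fin p, (T i (Fin.castLE hpn j))^2 * (b (Fin.castLE hpn j) / b i) =
      ∑ i, ∑ j : Fin p, (T i (Fin.castLE hpn j))^2 +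
      ∑ i, ∑ j : Fin p, (T i (Fin.castLE hpn j))^2 * (b (Fin.castLE hpn j) / b i - 1) := by
    rw [← Finset.sum_add_distrib]
    refine Finset.sum_congr rfl fun i _ => ?_
    rw [← Finset.sum_add_distrib]
    refine Finset.sum_congr rfl fun j _ => ?_
    ring
  linarith

lemma rowpt {κ x w y : ℝ} (hκ : 1 ≤ κ) (h1 : 1 + 1 / κ ≤ x) (h2 : x ≤ 1 + κ) :
    w ^ 2 ≤ omegaFn κ * (w - y)^2 + x * (w * y) := by
  have hω : 1 ≤ omegaFn κ := omega_one_le hκ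
  have e : 4 * omegaFn κ = κ + 2 + 1 / κ := by rw [omega_eq (by linarith)]; ring
  set ω := omegaFn κ
  have hk : κ * (1 / κ) = 1 := by field_simp
  have hq : x^2 - 4 * ω * x + 4 * ω ≤ 0 := by
    rw [e]
    nlinarith [mul_nonneg (sub_nonneg.2 h1) (sub_nonneg.2 h2)]
  have key : 0 ≤ ω * (ω * (w - y)^2 + x * (w * y) - w^2) := by
    have : ω * (ω * (w - y)^2 + x * (w * y) - w^2) =
        (ω * y + (x - 2 * ω)/2 * w)^2 + (-(x^2 - 4 * ω * x + 4 * ω)/4) * w^2 := by ring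
    rw [this]
    have : 0 ≤ (-(x^2 - 4 * ω * x + 4 * ω)/4) * w^2 := by
      apply mul_nonneg _ (sq_nonneg _); linarith
    positivity
  have := nonneg_of_mul_nonneg_right key (by linarith)
  linarith

lemma rowscalar (n p : ℕ) (hpn : p ≤ n) (hp : 1 ≤ p) (b : Fin n → ℝ) (hb : Monotone b)
    (hb0 : ∀ i, 0 < b i) (μ : ℝ) (hμ : 0 < μ) (w y : Fin n → ℝ)
    (H : ∑ j, (1 / b j + μ) * (w j * y j) = 0) :
    ∑ j : Fin p, (w (Fin.castLE hpn j))^2 ≤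
      omegaFn (b ⟨p - 1, by omega⟩ / b ⟨0, by omega⟩) * ∑ j, (w j - y j)^2 := by
  set b0 := b ⟨0, by omega⟩ with hb0d
  set b1 := b ⟨p - 1, by omega⟩ with hb1d
  have h0 : 0 < b0 := hb0 _
  have h1 : 0 < b1 := hb0 _
  have h01 : b0 ≤ b1 := hb (by simp [Fin.le_def])
  obtain ⟨κ, hκd⟩ : ∃ κ, κ = b1 / b0 := ⟨_, rfl⟩
  have hκ : 1 ≤ κ := by rw [hκd, le_div_iff₀ h0]; linarith
  have hκ0 : 0 < κ := by linarith
  rw [← hκd]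
  have he0 : 0 < 1 / b0 + μ := by positivity
  obtain ⟨t, ht⟩ : ∃ t, t = (1 + κ) / (1 / b0 + μ) := ⟨_, rfl⟩
  have ht0 : 0 < t := by rw [ht]; positivity
  have hte : t * (1 / b0 + μ) = 1 + κ := by rw [ht]; field_simp
  have hup : ∀ j, t * (1 / b j + μ) ≤ 1 + κ := by
    intro j
    rw [← hte]
    have : 1 / b j ≤ 1 / b0 := one_div_le_one_div_of_le h0 (hb (by simp [Fin.le_def]))
    gcongr
  have hlow : ∀ j : Fin n, j.val < p → 1 + 1 / κ ≤ t * (1 / b j + μ) := by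
    intro j hj
    have h2 : 1 / b1 ≤ 1 / b j := one_div_le_one_div_of_le (hb0 j) (hb (by rw [Fin.le_def]; simp; omega))
    have h3 : 1 / b0 + μ ≤ κ * (1 / b1 + μ) := by
      have : κ * (1 / b1) = 1 / b0 := by rw [hκd]; field_simp
      nlinarith
    have h4 : 1 + κ ≤ κ * (t * (1 / b j + μ)) := by
      rw [← hte]
      calc t * (1 / b0 + μ) ≤ t * (κ * (1 / b1 + μ)) := by gcongr
        _ ≤ t * (κ * (1 / b j + μ)) := by gcongr
        _ = _ := by ring
    have : 1 + 1 / κ = (1 + κ) / κ := by field_simp; ring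
    rw [this, div_le_iff₀ hκ0]; linarith
  have hω := omega_one_le hκ
  have e : 4 * omegaFn κ = κ + 2 + 1 / κ := by rw [omega_eq (by linarith)]; ring
  rw [sum_castLE hpn (fun j => (w j)^2)]
  have : ∑ j : Fin n, (if j.val < p then (w j)^2 else 0) ≤
      ∑ j, (omegaFn κ * (w j - y j)^2 + t * ((1 / b j + μ) * (w j * y j))) := by
    refine Finset.sum_le_sum fun j _ => ?_
    split_ifs with hj
    · have := rowpt (w := w j) (y := y j) hκ (hlow j hj) (hup j)
      linarith
    · have hx := hup j
      have hx0 : 0 ≤ t * (1 / b j + μ) := by have := hb0 j; positivity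
      have hk : 0 < 1 / κ := by positivity
      set x := t * (1 / b j + μ)
      have e2 : t * ((1 / b j + μ) * (w j * y j)) = x * (w j * y j) := by ring
      rw [e2]
      nlinarith [mul_nonneg hx0 (sq_nonneg (w j + y j)),
        mul_nonneg (by linarith : 0 ≤ 4 * omegaFn κ - x) (sq_nonneg (w j - y j))]
  rw [Finset.sum_add_distrib, ← Finset.mul_sum, ← Finset.mul_sum, H, mul_zero, add_zero] at this
  exact this

lemma Bsum (n p m : ℕ) (hpn : p ≤ n) (hm : 1 ≤ m) (hmN : m ≤ n + 1) (lam : Fin (n+1) → ℝ)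
    (h0 : lam 0 = 0) :
    ((m - 1 : ℕ) : ℝ) + (∑ l : Fin p, if l.val < m - 1 then
        omegaFn (max 1 (lam (Fin.castLE hpn (Fin.rev l)).succ / lam (Fin.castLE hpn l).succ)) - 1 else 0) =
    ∑ i ∈ Finset.Icc 2 m, omegaFn (max 1 (eig1 lam (p + 1 + 2 - i) / eig1 lam i)) := by
  have e1 : ∑ i ∈ Finset.Icc 2 m, omegaFn (max 1 (eig1 lam (p + 1 + 2 - i) / eig1 lam i)) =
      ∑ l ∈ Finset.range (m - 1), omegaFn (max 1 (eig1 lam (p + 1 - l) / eig1 lam (l + 2))) := by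
    rw [show Finset.Icc 2 m = Finset.Ico 2 (m+1) from rfl, Finset.sum_Ico_eq_sum_range]
    rw [show m + 1 - 2 = m - 1 by omega]
    refine Finset.sum_congr rfl fun l _ => ?_
    rw [show p + 1 + 2 - (2 + l) = p + 1 - l by omega, add_comm 2 l]
  rw [e1]
  obtain ⟨g, hg⟩ : ∃ g : ℕ → ℝ, g = fun l => omegaFn (max 1 (eig1 lam (p + 1 - l) / eig1 lam (l + 2))) :=
    ⟨_, rfl⟩
  have e2 : (∑ l : Fin p, if l.val < m - 1 then
        omegaFn (max 1 (lam (Fin.castLE hpn (Fin.rev l)).succ / lam (Fin.castLE hpn l).succ)) - 1 else 0) =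
      ∑ l : Fin p, (fun l : ℕ => if l < m - 1 then g l - 1 else 0) l.val := by
    refine Finset.sum_congr rfl fun l _ => ?_
    have hl := l.2
    simp only
    split_ifs with h
    · rw [hg]
      have a1 : eig1 lam (p + 1 - l.val) = lam (Fin.castLE hpn (Fin.rev l)).succ := by
        unfold eig1
        rw [dif_pos (by omega)]
        congr 1
        ext; simp; omega
      have a2 : eig1 lam (l.val + 2) = lam (Fin.castLE hpn l).succ := by
        unfold eig1
        rw [dif_pos (by omega)]
        congr 1
      simp only [a1, a2]
    · rfl
  have e3 : ∀ l, p ≤ l → g l - 1 = 0 := by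
    intro l hl
    have : eig1 lam (p + 1 - l) = 0 := by
      unfold eig1
      rw [dif_pos (by omega)]
      rw [← h0]; congr 1; ext; simp; omega
    rw [hg]
    simp only [this, zero_div]
    rw [max_eq_left zero_le_one, omega_eq one_pos]; norm_num
  rw [e2, Fin.sum_univ_eq_sum_range (fun l : ℕ => if l < m - 1 then g l - 1 else 0) p]
  have e4 : ∑ l ∈ Finset.range p, (if l < m - 1 then g l - 1 else 0) =
      ∑ l ∈ Finset.range (m - 1), (g l - 1) := by
    rw [← Finset.sum_filter]
    apply Finset.sum_subset_zero_on_sdiff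
    · intro l; simp
    · intro l hl
      simp only [Finset.mem_sdiff, Finset.mem_range, Finset.mem_filter, not_and] at hl
      exact e3 l (by by_contra h; exact hl.2 (by omega) hl.1)
    · intro l _; rfl
  rw [e4, Finset.sum_sub_distrib, hg]
  simp

lemma psd_one {n : ℕ} (P L Ai : Matrix (Fin n) (Fin n) ℝ) (μ : ℝ) (hμ : 0 < μ)
    (hP : P.PosSemidef) (hL : L.PosSemidef) (hPt : Pᵀ = P)
    (hAit : Aiᵀ = Ai)
    (h1 : (P + μ • L) * Ai = 1) (h2 : Ai * (P + μ • L) = 1) :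
    (L * (Ai * P)).PosSemidef := by
  have e0 : P * Ai + μ • (L * Ai) = 1 := by rw [← h1, add_mul, smul_mul_assoc]
  have e2 : Ai * P + μ • (Ai * L) = 1 := by rw [← h2, mul_add, mul_smul_comm]
  have e1 : μ • (L * (Ai * P)) = (1 - Ai * P)ᵀ * P * (1 - Ai * P) + μ • ((Ai * P)ᵀ * L * (Ai * P)) := by
    have q : P * Ai * (P + μ • L) * (Ai * P) = P * Ai * P := by
      rw [mul_assoc (P * Ai), ← mul_assoc _ Ai P, h1, one_mul]
    have q2 : μ • (L * (Ai * P)) = P - P * Ai * P := by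
      have : μ • (L * (Ai * P)) = (μ • (L * Ai)) * P := by
        rw [smul_mul_assoc, mul_assoc]
      rw [this, eq_sub_of_add_eq' e0, sub_mul, one_mul]
    rw [q2, Matrix.transpose_sub, Matrix.transpose_mul, hPt, hAit, Matrix.transpose_one]
    have q3 : P * Ai * P * (Ai * P) + μ • (P * Ai * L * (Ai * P)) = P * Ai * P := by
      have q' := q
      rw [mul_add, add_mul] at q'
      simpa only [mul_smul_comm, smul_mul_assoc] using q'
    have q4 : (1 - P * Ai) * P * (1 - Ai * P) = P - P * Ai * P - P * Ai * P + P * Ai * P * (Ai * P) := by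
      noncomm_ring
    rw [q4, add_assoc, q3]; abel
  have h3 : (μ • (L * (Ai * P))).PosSemidef := by
    rw [e1]
    have a1 := hP.conjTranspose_mul_mul_same (1 - Ai * P)
    have a2 := hL.conjTranspose_mul_mul_same (Ai * P)
    rw [Matrix.conjTranspose_eq_transpose_of_trivial] at a1 a2
    exact a1.add (a2.smul hμ.le)
  have := h3.smul (inv_nonneg.2 hμ.le)
  rwa [smul_smul, inv_mul_cancel₀ hμ.ne', one_smul] at this

lemma psd_two {n : ℕ} (P L Ai : Matrix (Fin n) (Fin n) ℝ) (μ : ℝ) (hμ : 0 < μ)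
    (hP : P.PosSemidef) (hL : L.PosSemidef) (hLt : Lᵀ = L)
    (hAit : Aiᵀ = Ai)
    (h2 : Ai * (P + μ • L) = 1) :
    (L - L * (Ai * P)).PosSemidef := by
  have e2 : Ai * P + μ • (Ai * L) = 1 := by rw [← h2, mul_add, mul_smul_comm]
  have hA : (P + μ • L).PosSemidef := hP.add (hL.smul hμ.le)
  have hAi : Ai.PosSemidef := by
    have := hA.conjTranspose_mul_mul_same Ai
    have e : Aiᴴ = Ai := hAit
    rwa [e, h2, one_mul] at this
  have e3 : L - L * (Ai * P) = μ • (Lᴴ * Ai * L) := by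
    have e : Lᴴ = L := hLt
    rw [e, eq_sub_of_add_eq e2, mul_sub, mul_one, sub_sub_cancel, mul_smul_comm, mul_assoc]
  rw [e3]
  exact (hAi.conjTranspose_mul_mul_same L).smul hμ.le

lemma rank_block {n : ℕ} (S : Finset (Fin (n+1))) (hS : S.Nonempty)
    (X U C : Matrix (Fin (n+1)) (Fin (n+1)) ℝ)
    (hC : C = X * Matrix.diagonal (fun j => if j ∈ S then 1 else 0) * U)
    (c : ℝ) (hc : c ≠ 0) (hU0 : ∀ i, U i 0 = c) (hC0 : ∀ i : Fin n, C i.succ 0 = 0) :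
    (C.submatrix Fin.succ Fin.succ).rank ≤ S.card - 1 := by
  obtain ⟨s0, hs0⟩ := hS
  have hCe : ∀ i j, C i j = ∑ s ∈ S, X i s * U s j := by
    intro i j
    rw [hC, Matrix.mul_apply, ← Finset.sum_filter_add_sum_filter_not Finset.univ (· ∈ S)]
    rw [Finset.sum_eq_zero (s := Finset.univ.filter (fun x => ¬ x ∈ S))]
    · simp only [Finset.filter_univ_mem, add_zero]
      refine Finset.sum_congr rfl fun s hs => ?_
      rw [Matrix.mul_diagonal, if_pos hs, mul_one]
    · intro s hs
      rw [Matrix.mul_diagonal, if_neg (Finset.mem_filter.1 hs).2]; ring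
  have hz : ∀ i : Fin n, ∑ s ∈ S, X i.succ s = 0 := by
    intro i
    have := hC0 i
    rw [hCe] at this
    simp only [hU0, ← Finset.sum_mul] at this
    exact (mul_eq_zero.1 this).resolve_right hc
  have hfac : C.submatrix Fin.succ Fin.succ =
      (Matrix.of fun (i : Fin n) (s : ↥(S.erase s0)) => X i.succ s.1) *
      (Matrix.of fun (s : ↥(S.erase s0)) (j : Fin n) => U s.1 j.succ - U s0 j.succ) := by
    ext i j
    rw [Matrix.submatrix_apply, hCe, Matrix.mul_apply]
    simp only [Matrix.of_apply]
    rw [Finset.sum_coe_sort (S.erase s0) (fun s => X i.succ s * (U s j.succ - U s0 j.succ))]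
    rw [Finset.sum_erase S (by ring)]
    simp only [mul_sub, Finset.sum_sub_distrib, ← Finset.sum_mul, hz]
    ring
  rw [hfac]
  refine (Matrix.rank_mul_le_left _ _).trans ((Matrix.rank_le_card_width _).trans ?_)
  rw [Fintype.card_coe, Finset.card_erase_of_mem hs0]

lemma parseval {n : ℕ} (u : Fin n → Fin n → ℝ)
    (hortho : ∀ i j, u i ⬝ᵥ u j = if i = j then (1 : ℝ) else 0) (x y : Fin n → ℝ) :
    ∑ j, (u j ⬝ᵥ x) * (u j ⬝ᵥ y) = x ⬝ᵥ y := by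
  have h1 : (Matrix.of u) * (Matrix.of u)ᵀ = 1 := by
    ext i j
    rw [Matrix.one_apply, ← hortho i j]; rfl
  have h2 := mul_eq_one_comm.1 h1
  have : ((Matrix.of u) *ᵥ x) ⬝ᵥ ((Matrix.of u) *ᵥ y) = x ⬝ᵥ y := by
    rw [Matrix.dotProduct_mulVec, ← Matrix.mulVec_transpose, Matrix.mulVec_mulVec, h2, Matrix.one_mulVec]
  exact this

lemma block_bound {n p : ℕ} (hpn : p ≤ n) (lam : Fin (n+1) → ℝ) (hmono : StrictMono lam)
    (hlam0 : lam 0 = 0)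
    (P L Ai U C : Matrix (Fin (n+1)) (Fin (n+1)) ℝ) (r : ℕ)
    (hUU : Uᵀ * U = 1) (hLU : Uᵀ * L = Matrix.diagonal lam * Uᵀ)
    (hp1 : (L * (Ai * P)).PosSemidef) (hp2 : (L - L * (Ai * P)).PosSemidef)
    (hC : C = Uᵀ * (Ai * P) * U) (hr : (C.submatrix Fin.succ Fin.succ).rank ≤ r) :
    ∑ i : Fin n, ∑ j : Fin p, (C i.succ (Fin.castLE hpn j).succ)^2 ≤
      r + ∑ l : Fin p, if l.val < r then
        omegaFn (max 1 (lam (Fin.castLE hpn (Fin.rev l)).succ / lam (Fin.castLE hpn l).succ)) - 1 else 0 := by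
  have hb0 : ∀ i : Fin n, 0 < lam i.succ := fun i => by
    rw [← hlam0]; exact hmono (Fin.succ_pos i)
  have hb : Monotone (fun i : Fin n => lam i.succ) := fun i j h =>
    hmono.monotone (Fin.succ_le_succ_iff.2 h)
  set D : Matrix (Fin n) (Fin n) ℝ := Matrix.diagonal (fun i => 1 / √(lam i.succ)) with hD
  have hDt : Dᴴ = D := by
    rw [Matrix.conjTranspose_eq_transpose_of_trivial, hD, Matrix.diagonal_transpose]
  set Q := Uᵀ * (L * (Ai * P)) * U with hQ
  have hQC : Q = Matrix.diagonal lam * C := by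
    rw [hQ, hC, ← mul_assoc Uᵀ L, hLU]; simp only [mul_assoc]
  have hQ1 : Q.PosSemidef := by
    have := hp1.conjTranspose_mul_mul_same U
    rwa [Matrix.conjTranspose_eq_transpose_of_trivial] at this
  have hQ2 : (Matrix.diagonal lam - Q).PosSemidef := by
    have := hp2.conjTranspose_mul_mul_same U
    rw [Matrix.conjTranspose_eq_transpose_of_trivial, mul_sub, sub_mul, hLU, mul_assoc (diagonal lam),
      hUU, mul_one] at this
    exact this
  have hT0 : (D * Q.submatrix Fin.succ Fin.succ * D).PosSemidef := by
    have := (hQ1.submatrix Fin.succ).conjTranspose_mul_mul_same D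
    rwa [hDt] at this
  have hTe : ∀ i j, (D * Q.submatrix Fin.succ Fin.succ * D) i j =
      1 / √(lam i.succ) * (lam i.succ * C i.succ j.succ) * (1 / √(lam j.succ)) := by
    intro i j
    rw [hD, Matrix.mul_diagonal, Matrix.diagonal_mul, Matrix.submatrix_apply, hQC, Matrix.diagonal_mul]
  have hT1 : (1 - D * Q.submatrix Fin.succ Fin.succ * D).PosSemidef := by
    have := (hQ2.submatrix Fin.succ).conjTranspose_mul_mul_same D
    rw [hDt, Matrix.submatrix_sub, Pi.sub_apply, Pi.sub_apply, mul_sub, sub_mul] at this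
    convert this using 2
    ext i j
    rw [hD, Matrix.mul_diagonal, Matrix.diagonal_mul, Matrix.submatrix_apply, Matrix.one_apply,
      Matrix.diagonal_apply]
    by_cases h : i = j
    · subst h
      have h1 := Real.sq_sqrt (hb0 i).le
      have h2 := Real.sqrt_pos.2 (hb0 i)
      simp only [if_true]
      field_simp
      exact h1
    · simp [h]
  have hT2 : (D * Q.submatrix Fin.succ Fin.succ * D).rank ≤ r := by
    have e : Q.submatrix Fin.succ Fin.succ =
        Matrix.diagonal (fun i : Fin n => lam i.succ) * C.submatrix Fin.succ Fin.succ := by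
      ext i j
      rw [hQC, Matrix.submatrix_apply, Matrix.diagonal_mul, Matrix.diagonal_mul, Matrix.submatrix_apply]
    rw [e]
    exact ((Matrix.rank_mul_le_left _ _).trans ((Matrix.rank_mul_le_right _ _).trans
      (Matrix.rank_mul_le_right _ _))).trans hr
  have := bandcore n p r hpn (fun i => lam i.succ) hb hb0 _ hT0 hT1 hT2
  refine le_trans (le_of_eq ?_) this
  refine Finset.sum_congr rfl fun i _ => Finset.sum_congr rfl fun j _ => ?_
  rw [hTe]
  have h1 := Real.sq_sqrt (hb0 i).le
  have h2 := Real.sqrt_pos.2 (hb0 i)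
  have h3 := Real.sq_sqrt (hb0 (Fin.castLE hpn j)).le
  have h4 := Real.sqrt_pos.2 (hb0 (Fin.castLE hpn j))
  have h5 := hb0 i
  have h6 := hb0 (Fin.castLE hpn j)
  rw [mul_pow, mul_pow, mul_pow, div_pow, div_pow, h1, h3]
  field_simp

lemma row_bound {n p : ℕ} (hpn : p ≤ n) (hp : 1 ≤ p) (lam : Fin (n+1) → ℝ) (hmono : StrictMono lam)
    (hlam0 : lam 0 = 0) (u : Fin (n+1) → Fin (n+1) → ℝ)
    (hortho : ∀ i j, u i ⬝ᵥ u j = if i = j then (1 : ℝ) else 0)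
    (L : Matrix (Fin (n+1)) (Fin (n+1)) ℝ) (hLt : Lᵀ = L) (heig : ∀ i, L *ᵥ (u i) = lam i • u i)
    (μ : ℝ) (hμ : 0 < μ) (S : Finset (Fin (n+1))) (hS : S.Nonempty)
    (c : ℝ) (hc : ∀ i, u 0 i = c)
    (v w : Fin (n+1) → ℝ) (hw : ∀ i, w i = if i ∈ S then v i else 0)
    (hwv : w + μ • (L *ᵥ v) = u 0) :
    ∑ j : Fin p, (u (Fin.castLE hpn j).succ ⬝ᵥ w)^2 ≤
      omegaFn (lam (⟨p - 1, by omega⟩ : Fin n).succ / lam (⟨0, by omega⟩ : Fin n).succ) *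
        (((n+1 : ℕ) : ℝ) / S.card) := by
  have hb0 : ∀ i : Fin n, 0 < lam i.succ := fun i => by
    rw [← hlam0]; exact hmono (Fin.succ_pos i)
  have hb : Monotone (fun i : Fin n => lam i.succ) := fun i j h =>
    hmono.monotone (Fin.succ_le_succ_iff.2 h)
  have hm : (0:ℝ) < S.card := by exact_mod_cast hS.card_pos
  have hcc : ((n:ℝ)+1) * c^2 = 1 := by
    have := hortho 0 0
    simp only [dotProduct, hc, if_true] at this
    simp at this
    rw [sq]; exact this
  set q : ℝ := ((n:ℝ)+1) / S.card with hq
  set z : Fin (n+1) → ℝ := fun i => if i ∈ S then q * c else 0 with hz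
  have hzz : z ⬝ᵥ z = q := by
    have : z ⬝ᵥ z = S.card * (q * c * (q * c)) := by
      simp [dotProduct, hz]
    rw [this]
    have : (S.card:ℝ) * (q * c * (q * c)) = q * (S.card * q) * c^2 := by ring
    rw [this, hq, mul_div_cancel₀ _ hm.ne', mul_assoc, hcc, mul_one]
  have hz0 : u 0 ⬝ᵥ z = 1 := by
    have : u 0 ⬝ᵥ z = S.card * (c * (q * c)) := by
      simp [dotProduct, hz, hc]
    rw [this]
    have : (S.card:ℝ) * (c * (q * c)) = (S.card * q) * c^2 := by ring
    rw [this, hq, mul_div_cancel₀ _ hm.ne', hcc]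
  have huL : ∀ j x, u j ⬝ᵥ (L *ᵥ x) = lam j * (u j ⬝ᵥ x) := by
    intro j x
    rw [Matrix.dotProduct_mulVec, ← Matrix.mulVec_transpose, hLt, heig, smul_dotProduct, smul_eq_mul]
  have hhat : ∀ j, u j ⬝ᵥ w + μ * (lam j * (u j ⬝ᵥ v)) = if j = 0 then 1 else 0 := by
    intro j
    rw [← hortho j 0, ← hwv, dotProduct_add, dotProduct_smul, huL, smul_eq_mul]
  have hw0 : u 0 ⬝ᵥ w = 1 := by
    have := hhat 0
    simpa [hlam0] using this
  have hws : ∀ j : Fin n, u j.succ ⬝ᵥ w = - (μ * (lam j.succ * (u j.succ ⬝ᵥ v))) := by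
    intro j
    have := hhat j.succ
    rw [if_neg (Fin.succ_ne_zero j)] at this
    linarith
  have H : ∑ j : Fin n, (1 / lam j.succ + μ) * ((u j.succ ⬝ᵥ w) * (u j.succ ⬝ᵥ (w - z))) = 0 := by
    have h1 := parseval u hortho (w - v) (w - z)
    have h2 : (w - v) ⬝ᵥ (w - z) = 0 := by
      refine Finset.sum_eq_zero fun i _ => ?_
      simp only [Pi.sub_apply, hw, hz]
      by_cases h : i ∈ S <;> simp [h]
    rw [h2, Fin.sum_univ_succ, dotProduct_sub (u 0) w z, hw0, hz0, sub_self, mul_zero, zero_add] at h1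
    have h3 : ∑ j : Fin n, (1 / lam j.succ + μ) * ((u j.succ ⬝ᵥ w) * (u j.succ ⬝ᵥ (w - z))) =
        μ * ∑ j : Fin n, (u j.succ ⬝ᵥ (w - v)) * (u j.succ ⬝ᵥ (w - z)) := by
      rw [Finset.mul_sum]
      refine Finset.sum_congr rfl fun j _ => ?_
      rw [dotProduct_sub _ w v, hws j]
      have := hb0 j
      field_simp
      ring
    rw [h3, h1, mul_zero]
  have h := rowscalar n p hpn hp (fun i => lam i.succ) hb hb0 μ hμ
    (fun j => u j.succ ⬝ᵥ w) (fun j => u j.succ ⬝ᵥ (w - z)) H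
  refine h.trans ?_
  have hω : 1 ≤ omegaFn (lam (⟨p - 1, by omega⟩ : Fin n).succ / lam (⟨0, by omega⟩ : Fin n).succ) := by
    apply omega_one_le
    rw [one_le_div (hb0 _)]
    exact hb (by simp [Fin.le_def])
  refine mul_le_mul_of_nonneg_left ?_ (by linarith)
  have h4 := parseval u hortho z z
  rw [Fin.sum_univ_succ, hzz] at h4
  push_cast
  rw [← hq, ← h4]
  have : ∀ j : Fin n, (u j.succ ⬝ᵥ w - u j.succ ⬝ᵥ (w - z))^2 = (u j.succ ⬝ᵥ z) * (u j.succ ⬝ᵥ z) := by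
    intro j
    rw [dotProduct_sub]; ring
  simp only [this]
  nlinarith [mul_self_nonneg (u 0 ⬝ᵥ z)]

lemma first_part {n p : ℕ} (hpn : p ≤ n) (hp : 1 ≤ p)
    (G : SimpleGraph (Fin (n+1))) [DecidableRel G.Adj] (hG : G.Connected)
    (lam : Fin (n+1) → ℝ) (hmono : StrictMono lam) (hlam0 : lam 0 = 0)
    (u : Fin (n+1) → Fin (n+1) → ℝ)
    (hortho : ∀ i j, u i ⬝ᵥ u j = if i = j then (1 : ℝ) else 0)
    (heig : ∀ i, (G.lapMatrix ℝ).mulVec (u i) = lam i • u i)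
    (μ : ℝ) (hμ : 0 < μ)
    (S : Finset (Fin (n+1))) (hS : S.Nonempty) (P L : Matrix (Fin (n+1)) (Fin (n+1)) ℝ)
    (hP : P = Matrix.diagonal fun j => if j ∈ S then 1 else 0) (hL : L = G.lapMatrix ℝ)
    (hkN : p + 1 ≤ n + 1) :
    frobSq ((P + μ • L)⁻¹ * P * Matrix.of fun i (j : Fin (p+1)) => u (Fin.castLE hkN j) i) ≤
      1 + Bbl lam (p+1) S.card := by
  have hconst : ∀ x : Fin (n+1) → ℝ, L *ᵥ x = 0 → ∀ i j, x i = x j := by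
    intro x hx i j
    rw [hL] at hx
    exact (SimpleGraph.lapMatrix_mulVec_eq_zero_iff_forall_reachable G).1 hx i j (hG.preconnected i j)
  rw [← hL] at heig
  have hLp : L.PosSemidef := by rw [hL]; exact SimpleGraph.posSemidef_lapMatrix ℝ G
  have hLt : Lᵀ = L := by rw [hL]; exact G.isSymm_lapMatrix (R := ℝ)
  have hPt : Pᵀ = P := by rw [hP, Matrix.diagonal_transpose]
  have hPp : P.PosSemidef := by
    rw [hP]
    refine Matrix.PosSemidef.diagonal fun i => ?_
    by_cases h : i ∈ S <;> simp [h]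
  obtain ⟨c, hc⟩ : ∃ c, ∀ i, u 0 i = c := by
    refine ⟨u 0 0, fun i => hconst _ ?_ i 0⟩
    rw [heig, hlam0, zero_smul]
  have hc0 : c ≠ 0 := by
    intro h
    have := hortho 0 0
    simp [dotProduct, hc, h] at this
  have hPx : ∀ x : Fin (n+1) → ℝ, ∀ i, (P *ᵥ x) i = if i ∈ S then x i else 0 := by
    intro x i
    rw [hP, Matrix.mulVec_diagonal]; simp
  have hAdet : IsUnit (P + μ • L).det := by
    rw [isUnit_iff_ne_zero]
    intro h0
    obtain ⟨x, hx0, hx⟩ := Matrix.exists_mulVec_eq_zero_iff.2 h0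
    have e : x ⬝ᵥ (P *ᵥ x) + μ * (x ⬝ᵥ (L *ᵥ x)) = 0 := by
      rw [← smul_eq_mul, ← dotProduct_smul, ← dotProduct_add, ← Matrix.smul_mulVec, ← Matrix.add_mulVec, hx,
        dotProduct_zero]
    have p1 : 0 ≤ x ⬝ᵥ (P *ᵥ x) := hPp.dotProduct_mulVec_nonneg x
    have p2 : 0 ≤ x ⬝ᵥ (L *ᵥ x) := hLp.dotProduct_mulVec_nonneg x
    have p3 := mul_nonneg hμ.le p2
    have z1 : x ⬝ᵥ (P *ᵥ x) = 0 := by linarith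
    have z2 : x ⬝ᵥ (L *ᵥ x) = 0 := by
      have : μ * (x ⬝ᵥ (L *ᵥ x)) = 0 := by linarith
      exact (mul_eq_zero.1 this).resolve_left hμ.ne'
    have y1 : P *ᵥ x = 0 := (hPp.dotProduct_mulVec_zero_iff x).1 z1
    have y2 : L *ᵥ x = 0 := (hLp.dotProduct_mulVec_zero_iff x).1 z2
    obtain ⟨s, hs⟩ := hS
    have xs : x s = 0 := by
      have := hPx x s
      rw [y1, if_pos hs] at this
      exact this.symm
    apply hx0
    funext i
    rw [hconst x y2 i s, xs]; rfl
  set Ai := (P + μ • L)⁻¹ with hAi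
  have h1 : (P + μ • L) * Ai = 1 := Matrix.mul_nonsing_inv _ hAdet
  have h2 : Ai * (P + μ • L) = 1 := Matrix.nonsing_inv_mul _ hAdet
  have hAit : Aiᵀ = Ai := by
    rw [hAi, Matrix.transpose_nonsing_inv, Matrix.transpose_add, Matrix.transpose_smul, hPt, hLt]
  clear_value Ai
  set U : Matrix (Fin (n+1)) (Fin (n+1)) ℝ := Matrix.of fun i j => u j i with hU
  have hUU : Uᵀ * U = 1 := by
    ext i j
    rw [Matrix.one_apply, ← hortho i j]; rfl
  have hUU2 : U * Uᵀ = 1 := mul_eq_one_comm.1 hUU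
  have hLU0 : L * U = U * Matrix.diagonal lam := by
    ext i j
    have := congrFun (heig j) i
    rw [Matrix.mul_diagonal]
    simp only [Pi.smul_apply, smul_eq_mul] at this
    rw [mul_comm]
    exact this
  have hLU : Uᵀ * L = Matrix.diagonal lam * Uᵀ := by
    have := congrArg Matrix.transpose hLU0
    rwa [Matrix.transpose_mul, Matrix.transpose_mul, hLt, Matrix.diagonal_transpose] at this
  set C := Uᵀ * (Ai * P) * U with hC
  have hAPu : (Ai * P) *ᵥ u 0 = u 0 := by
    have : (P + μ • L) *ᵥ u 0 = P *ᵥ u 0 := by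
      rw [Matrix.add_mulVec, Matrix.smul_mulVec, heig, hlam0, zero_smul, smul_zero, add_zero]
    rw [← Matrix.mulVec_mulVec, ← this, Matrix.mulVec_mulVec, h2, Matrix.one_mulVec]
  have hCe : ∀ i j, C i j = u i ⬝ᵥ ((Ai * P) *ᵥ u j) := by
    intro i j
    rw [hC, mul_assoc]; rfl
  have hCc : ∀ i, C i 0 = if i = 0 then 1 else 0 := by
    intro i
    rw [hCe, hAPu, hortho]
  have hblock := block_bound hpn lam hmono hlam0 P L Ai U C (S.card - 1) hUU hLU
    (psd_one P L Ai μ hμ hPp hLp hPt hAit h1 h2) (psd_two P L Ai μ hμ hPp hLp hLt hAit h2) hC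
    (rank_block S hS (Uᵀ * Ai) U C (by rw [hC, ← hP]; simp only [mul_assoc]) c hc0
      (fun i => hc i) (fun i => by rw [hCc, if_neg (Fin.succ_ne_zero i)]))
  have hrow := row_bound hpn hp lam hmono hlam0 u hortho L hLt heig μ hμ S hS c hc
    (Ai *ᵥ u 0) (P *ᵥ (Ai *ᵥ u 0)) (hPx _) (by
      rw [← Matrix.smul_mulVec, ← Matrix.add_mulVec, Matrix.mulVec_mulVec, h1, Matrix.one_mulVec])
  have hC0 : ∀ j, C 0 j = u j ⬝ᵥ (P *ᵥ (Ai *ᵥ u 0)) := by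
    intro j
    rw [hCe, Matrix.dotProduct_mulVec, ← Matrix.mulVec_transpose, Matrix.transpose_mul, hPt, hAit,
      dotProduct_comm, Matrix.mulVec_mulVec]
  simp only [← hC0] at hrow
  have hB := Bsum n p S.card hpn hS.card_pos (by simpa using S.card_le_univ) lam hlam0
  rw [hB] at hblock
  have hfrob : frobSq (Ai * P * Matrix.of fun i (j : Fin (p+1)) => u (Fin.castLE hkN j) i) =
      ∑ j : Fin (p+1), ∑ i, (C i (Fin.castLE hkN j))^2 := by
    unfold frobSq
    simp only [Matrix.trace, Matrix.diag]
    refine Finset.sum_congr rfl fun j _ => ?_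
    have := parseval u hortho ((Ai * P) *ᵥ u (Fin.castLE hkN j)) ((Ai * P) *ᵥ u (Fin.castLE hkN j))
    simp only [← hCe, ← sq] at this
    rw [this]; rfl
  rw [hfrob, Fin.sum_univ_succ]
  have t0 : ∑ i, (C i (Fin.castLE hkN 0))^2 = 1 := by
    have : Fin.castLE hkN 0 = 0 := rfl
    rw [this]
    simp [hCc]
  have t1 : ∀ j : Fin p, Fin.castLE hkN j.succ = (Fin.castLE hpn j).succ := fun j => rfl
  have e2 : eig1 lam 2 = lam (⟨0, by omega⟩ : Fin n).succ := by
    unfold eig1; rw [dif_pos (by omega)]; rfl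
  have ek : eig1 lam (p+1) = lam (⟨p-1, by omega⟩ : Fin n).succ := by
    unfold eig1; rw [dif_pos (by omega)]; congr 1; ext; simp; omega
  rw [t0]
  simp only [t1, Fin.sum_univ_succ (n := n), Finset.sum_add_distrib]
  rw [Finset.sum_comm]
  unfold Bbl
  rw [ek, e2]
  linarith

lemma second_part {n p m : ℕ} (hpn : p ≤ n) (hp : 1 ≤ p) (hm : 1 ≤ m) (hmn : m ≤ n + 1)
    (lam : Fin (n+1) → ℝ) (hmono : StrictMono lam) (hlam0 : lam 0 = 0) :
    1 + Bbl lam (p+1) m ≤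
      1 + omegaFn (eig1 lam (p+1) / eig1 lam 2) * (((n+1 : ℕ) : ℝ) / (m : ℝ) + (m : ℝ) - 1) := by
  have hnn : ∀ i, 0 ≤ lam i := fun i => by rw [← hlam0]; exact hmono.monotone (Fin.zero_le i)
  have e2 : eig1 lam 2 = lam ⟨1, by omega⟩ := by
    unfold eig1; rw [dif_pos (by omega)]
  have e2p : 0 < eig1 lam 2 := by
    rw [e2, ← hlam0]; exact hmono (by simp [Fin.lt_def])
  have mono1 : ∀ a b : ℕ, a ≤ b → b ≤ n + 1 → eig1 lam a ≤ eig1 lam b := by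
    intro a b hab hb
    unfold eig1
    rw [dif_pos (by omega), dif_pos (by omega)]
    exact hmono.monotone (by rw [Fin.le_def]; simp only; omega)
  have key : ∀ i ∈ Finset.Icc 2 m, omegaFn (max 1 (eig1 lam (p + 1 + 2 - i) / eig1 lam i)) ≤
      omegaFn (eig1 lam (p+1) / eig1 lam 2) := by
    intro i hi
    rw [Finset.mem_Icc] at hi
    refine omega_mono (le_max_left _ _) (max_le ?_ ?_)
    · rw [one_le_div e2p]; exact mono1 _ _ (by omega) (by omega)
    · have a1 := mono1 (p + 1 + 2 - i) (p + 1) (by omega) (by omega)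
      have a2 := mono1 2 i hi.1 (by omega)
      have a3 := mono1 2 (p + 1) (by omega) (by omega)
      exact div_le_div₀ (by linarith) a1 e2p a2
  have hs := Finset.sum_le_card_nsmul _ _ _ key
  rw [Nat.card_Icc, nsmul_eq_mul] at hs
  have : ((m + 1 - 2 : ℕ) : ℝ) = m - 1 := by
    rw [show m + 1 - 2 = m - 1 by omega, Nat.cast_sub hm, Nat.cast_one]
  rw [this] at hs
  unfold Bbl
  linarith

/-- Paper's Lemma 3 (`GLR_xi_2_bound_main_bl`): for any nonempty sample set `S` of size `m`
and any `μ > 0`, the GLR `k`-bandlimited noise-sensitivity satisfies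
`ξ₂ᵇˡ(S) = ‖(P_S + μL)⁻¹ P_S U_K‖_F² ≤ 1 + B_k(m) ≤ 1 + r_bl·(N/m + m − 1)`. -/
theorem stmt_13 (N k : ℕ) (hN : 2 ≤ N) (hk2 : 2 ≤ k) (hkN : k ≤ N)
    (G : SimpleGraph (Fin N)) [DecidableRel G.Adj] (hG : G.Connected)
    (lam : Fin N → ℝ) (hmono : StrictMono lam) (hlam0 : lam ⟨0, by omega⟩ = 0)
    (u : Fin N → Fin N → ℝ)
    (hortho : ∀ i j, u i ⬝ᵥ u j = if i = j then (1 : ℝ) else 0)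
    (heig : ∀ i, (G.lapMatrix ℝ).mulVec (u i) = lam i • u i)
    (μ : ℝ) (hμ : 0 < μ)
    (S : Finset (Fin N)) (hS : S.Nonempty) :
    let L := G.lapMatrix ℝ
    let UK : Matrix (Fin N) (Fin k) ℝ := Matrix.of fun i j => u (Fin.castLE hkN j) i
    let P : Matrix (Fin N) (Fin N) ℝ := Matrix.diagonal fun j => if j ∈ S then 1 else 0
    let m := S.card
    let rbl := omegaFn (eig1 lam k / eig1 lam 2)
    frobSq ((P + μ • L)⁻¹ * P * UK) ≤ 1 + Bbl lam k m ∧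
    1 + Bbl lam k m ≤ 1 + rbl * ((N : ℝ) / (m : ℝ) + (m : ℝ) - 1) := by
  obtain ⟨n, rfl⟩ : ∃ n, N = n + 1 := ⟨N - 1, by omega⟩
  obtain ⟨p, rfl⟩ : ∃ p, k = p + 1 := ⟨k - 1, by omega⟩
  intro L UK P m rbl
  refine ⟨?_, ?_⟩
  · exact first_part (by omega) (by omega) G hG lam hmono hlam0 u hortho heig μ hμ S hS P L rfl rfl hkN
  · exact second_part (by omega) (by omega) hS.card_pos (by simpa using S.card_le_univ) lam hmono hlam0
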